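/- Unbiasedness of the count sketch inner product (Property 1, first part): for all vectors x, y ∈ ℝ^{K}, E_{h,s}[⟨P(h,s).mulVec x, P(h,s).mulVec y⟩] = ⟨x, y⟩, where the inner products are the Euclidean inner products on ℝ^{K'} and ℝ^{K} respectively. -/

import Mathlib

open Matrix BigOperators Finset

/-- The count sketch matrix `P(h,s)`. -/
def sketchP (K K' : ℕ) (h : Fin K → Fin K') (s : Fin K → ℝ) :
    Matrix (Fin K') (Fin K) ℝ :=
  Matrix.of fun i j => if h j = i then s j else 0

/-- Expectation (average) over the uniform distribution on pairs `(h, s)` with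
`h : Fin K → Fin K'` and `s : Fin K → {-1, 1}`. -/
noncomputable def sketchE (K K' : ℕ)
    (f : (Fin K → Fin K') → (Fin K → ℝ) → ℝ) : ℝ :=
  (∑ ω : (Fin K → Fin K') × (Fin K → ({-1, 1} : Finset ℝ)),
      f ω.1 (fun j => (ω.2 j : ℝ))) /
    (Fintype.card ((Fin K → Fin K') × (Fin K → ({-1, 1} : Finset ℝ))) : ℝ)

/-- Variance over the uniform distribution on pairs `(h, s)`. -/
noncomputable def sketchVar (K K' : ℕ)
    (f : (Fin K → Fin K') → (Fin K → ℝ) → ℝ) : ℝ :=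
  sketchE K K' (fun h s => (f h s) ^ 2) - (sketchE K K' f) ^ 2

/-- Negation on the set of signs. -/
def signFlip (a : ({-1, 1} : Finset ℝ)) : ({-1, 1} : Finset ℝ) :=
  ⟨-a.1, by
    have h := a.2
    simp only [Finset.mem_insert, Finset.mem_singleton] at h ⊢
    rcases h with h | h <;> simp [h]⟩

theorem signFlip_signFlip (a : ({-1, 1} : Finset ℝ)) : signFlip (signFlip a) = a :=
  Subtype.ext (neg_neg _)

theorem sketch_sign_sq (a : ({-1, 1} : Finset ℝ)) : (a : ℝ) * a = 1 := by
  have h := a.2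
  simp only [Finset.mem_insert, Finset.mem_singleton] at h
  rcases h with h | h <;> simp [h]

/-- Distinct signs are uncorrelated. -/
theorem sum_sign_mul_of_ne (K : ℕ) (j k : Fin K) (hjk : j ≠ k) :
    ∑ s : Fin K → ({-1, 1} : Finset ℝ), (s j : ℝ) * (s k : ℝ) = 0 := by
  have hinv : Function.Involutive
      (fun s : Fin K → ({-1, 1} : Finset ℝ) => Function.update s j (signFlip (s j))) := by
    intro s
    simp [signFlip_signFlip]
  let e : Equiv.Perm (Fin K → ({-1, 1} : Finset ℝ)) := Function.Involutive.toPerm _ hinv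
  have h := Equiv.sum_comp e
    (fun s : Fin K → ({-1, 1} : Finset ℝ) => (s j : ℝ) * (s k : ℝ))
  have h2 : ∀ s : Fin K → ({-1, 1} : Finset ℝ),
      ((e s) j : ℝ) * ((e s) k : ℝ) = -((s j : ℝ) * (s k : ℝ)) := by
    intro s
    simp [e, Function.Involutive.coe_toPerm, Function.update_of_ne hjk.symm, signFlip]
  simp only [h2, Finset.sum_neg_distrib] at h
  linarith

/-- Expansion of the sketched inner product as a double sum. -/
theorem sketch_inner_expand (K K' : ℕ) (h : Fin K → Fin K') (s x y : Fin K → ℝ) :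
    ∑ i : Fin K', ((sketchP K K' h s).mulVec x) i * ((sketchP K K' h s).mulVec y) i =
      ∑ j, ∑ k, (if h k = h j then x j * y k else 0) * (s j * s k) := by
  simp only [Matrix.mulVec, dotProduct, sketchP, Matrix.of_apply, Finset.sum_mul_sum]
  rw [Finset.sum_comm]
  refine Finset.sum_congr rfl fun j _ => ?_
  rw [Finset.sum_comm]
  refine Finset.sum_congr rfl fun k _ => ?_
  rw [Finset.sum_eq_single (h j)]
  · by_cases hk : h k = h j
    · simp [hk]; ring
    · simp [hk]
  · intro i _ hi
    simp [hi.symm]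
  · simp

/-- Averaging over the signs for a fixed hash function. -/
theorem sketch_sum_sign (K K' : ℕ) (h : Fin K → Fin K') (x y : Fin K → ℝ) :
    ∑ s : Fin K → ({-1, 1} : Finset ℝ),
      ∑ j, ∑ k, (if h k = h j then x j * y k else 0) * ((s j : ℝ) * (s k : ℝ)) =
      (Fintype.card (Fin K → ({-1, 1} : Finset ℝ)) : ℝ) * ∑ j, x j * y j := by
  rw [Finset.sum_comm, Finset.mul_sum]
  refine Finset.sum_congr rfl fun j _ => ?_
  rw [Finset.sum_comm, Finset.sum_eq_single j]
  · simp only [sketch_sign_sq, if_true, mul_one, Finset.sum_const, Finset.card_univ, nsmul_eq_mul]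
  · intro k _ hk
    rw [← Finset.mul_sum, sum_sign_mul_of_ne K j k hk.symm, mul_zero]
  · simp

/-- unbiasedness of the count sketch inner product:
`E[⟨Px, Py⟩] = ⟨x, y⟩`. -/
theorem countSketch_inner_unbiased (K K' : ℕ) (hK : 0 < K) (hK' : 0 < K')
    (x y : Fin K → ℝ) :
    sketchE K K' (fun h s =>
        ∑ i : Fin K', ((sketchP K K' h s).mulVec x) i * ((sketchP K K' h s).mulVec y) i) =
      ∑ j : Fin K, x j * y j := by
  haveI : Nonempty (Fin K') := ⟨⟨0, hK'⟩⟩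
  haveI : Nonempty ({-1, 1} : Finset ℝ) := ⟨⟨1, by simp⟩⟩
  have hc : (Fintype.card ((Fin K → Fin K') × (Fin K → ({-1, 1} : Finset ℝ))) : ℝ) ≠ 0 :=
    Nat.cast_ne_zero.mpr Fintype.card_ne_zero
  unfold sketchE
  rw [div_eq_iff hc]
  simp only [sketch_inner_expand]
  rw [Fintype.sum_prod_type]
  simp only [sketch_sum_sign]
  rw [Finset.sum_const, Finset.card_univ, nsmul_eq_mul, Fintype.card_prod, Nat.cast_mul]
  ring
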